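/- arXiv:2507.06714 — 3 statements merged into one kernel-verified Lean document; each statement's English description precedes it below -/
import Mathlib

section
/- Let N ≥ 1 be an integer, p_1,…,p_N > 1 and λ_1,…,λ_N real numbers, with p_+ := max_i p_i, λ_+ := max_i λ_i, λ_− := min_i λ_i and 1/p := (1/N)·Σ_{i=1}^N 1/p_i. Let C_* > 1 and suppose λ_+ − λ_− ≤ (p·ln 4)/(N·ln C_*). Then for every y ∈ ℝ^N, all k, r > 0, every α_0 ∈ (0,1) and every Lebesgue-measurable set E ⊆ ℝ^N: if |K^k_r(y) ∩ E| ≥ α_0 · |K^k_r(y)|, then |K^{k/C_*}_{4r}(y) ∩ E| ≥ (α_0 / 4^{N·p_+/p + 1}) · |K^{k/C_*}_{4r}(y)|. -/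
open MeasureTheory

/-- Rescaling the half-widths of an open box by nonnegative factors multiplies its volume by their
product. -/
lemma volume_box_mul {ι : Type*} [Fintype ι] (y a c : ι → ℝ) (hc : ∀ i, 0 ≤ c i) :
    volume {x : ι → ℝ | ∀ i, |x i - y i| < a i * c i} =
      ENNReal.ofReal (∏ i, c i) * volume {x : ι → ℝ | ∀ i, |x i - y i| < a i} := by
  have box (w : ι → ℝ) : volume {x : ι → ℝ | ∀ i, |x i - y i| < w i} =
      ∏ i, ENNReal.ofReal (2 * w i) := by
    have hset : {x : ι → ℝ | ∀ i, |x i - y i| < w i} =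
        Set.univ.pi fun i => Set.Ioo (y i - w i) (y i + w i) := by
      ext x
      simp only [Set.mem_ofPred_eq, Set.mem_univ_pi, Set.mem_Ioo, abs_sub_lt_iff]
      refine forall_congr' fun i => ?_
      constructor <;> rintro ⟨h₁, h₂⟩ <;> constructor <;> linarith
    rw [hset, Real.volume_pi_Ioo]
    refine Finset.prod_congr rfl fun i _ => ?_
    congr 1
    ring
  rw [box, box, ENNReal.ofReal_prod_of_nonneg fun i _ => hc i, ← Finset.prod_mul_distrib]
  refine Finset.prod_congr rfl fun i _ => ?_
  rw [← ENNReal.ofReal_mul (hc i)]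
  congr 1
  ring

/-- If every half-width of a box grows by a factor `c i ≥ 1` and the total volume factor is at most
`M`, then the relative density of a set in the box drops at most by the factor `M`. -/
lemma density_box_mul {ι : Type*} [Fintype ι] (y a c : ι → ℝ) (ha : ∀ i, 0 ≤ a i)
    (hc : ∀ i, 1 ≤ c i) {M α : ℝ} (hM : ∏ i, c i ≤ M) (hα : 0 ≤ α) (E : Set (ι → ℝ))
    (h : ENNReal.ofReal α * volume {x : ι → ℝ | ∀ i, |x i - y i| < a i} ≤
      volume ({x : ι → ℝ | ∀ i, |x i - y i| < a i} ∩ E)) :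
    ENNReal.ofReal (α / M) * volume {x : ι → ℝ | ∀ i, |x i - y i| < a i * c i} ≤
      volume ({x : ι → ℝ | ∀ i, |x i - y i| < a i * c i} ∩ E) := by
  have hprod : 0 < ∏ i, c i := Finset.prod_pos fun i _ => zero_lt_one.trans_le (hc i)
  have hMpos : 0 < M := hprod.trans_le hM
  have hfactor : α / M * ∏ i, c i ≤ α := by
    rw [div_mul_eq_mul_div, div_le_iff₀ hMpos]
    exact mul_le_mul_of_nonneg_left hM hα
  calc
    _ = ENNReal.ofReal (α / M * ∏ i, c i) * volume {x : ι → ℝ | ∀ i, |x i - y i| < a i} := by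
      rw [volume_box_mul y a c fun i => zero_le_one.trans (hc i), ← mul_assoc,
        ← ENNReal.ofReal_mul (div_nonneg hα hMpos.le)]
    _ ≤ ENNReal.ofReal α * volume {x : ι → ℝ | ∀ i, |x i - y i| < a i} := by gcongr
    _ ≤ _ := h
    _ ≤ _ := measure_mono <| Set.inter_subset_inter_left E fun x hx i =>
      (hx i).trans_le (le_mul_of_one_le_right (ha i) (hc i))

/-- measure-density transfer from the intrinsic cube `K^k_r(y)` to the
enlarged cube `K^{k/C_*}_{4r}(y)` under the exponent-gap restriction
`λ₊ − λ₋ ≤ p·ln 4/(N·ln C_*)`. -/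
theorem intrinsic_cube_density_transfer
    (N : ℕ) (hN : 1 ≤ N) (p lam : Fin N → ℝ) (hp : ∀ i, 1 < p i)
    (pplus lplus lminus pbar : ℝ)
    (hpplus : IsGreatest (Set.range p) pplus)
    (hlplus : IsGreatest (Set.range lam) lplus)
    (hlminus : IsLeast (Set.range lam) lminus)
    (hpbar : 1 / pbar = (1 / (N : ℝ)) * ∑ i, 1 / p i)
    (Cstar : ℝ) (hCstar : 1 < Cstar)
    (hgap : lplus - lminus ≤ pbar * Real.log 4 / ((N : ℝ) * Real.log Cstar))
    (y : Fin N → ℝ) (k r : ℝ) (hk : 0 < k) (hr : 0 < r)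
    (α₀ : ℝ) (hα₀ : α₀ ∈ Set.Ioo (0 : ℝ) 1)
    (E : Set (Fin N → ℝ)) (hE : MeasurableSet E)
    (hdensity : ENNReal.ofReal α₀ *
        volume {x : Fin N → ℝ | ∀ i,
          |x i - y i| < r ^ (pplus / p i) * k ^ (-((lplus - lam i) / p i))}
      ≤ volume ({x : Fin N → ℝ | ∀ i,
          |x i - y i| < r ^ (pplus / p i) * k ^ (-((lplus - lam i) / p i))} ∩ E)) :
    ENNReal.ofReal (α₀ / 4 ^ ((N : ℝ) * pplus / pbar + 1)) *
        volume {x : Fin N → ℝ | ∀ i,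
          |x i - y i| < (4 * r) ^ (pplus / p i) * (k / Cstar) ^ (-((lplus - lam i) / p i))}
      ≤ volume ({x : Fin N → ℝ | ∀ i,
          |x i - y i| < (4 * r) ^ (pplus / p i) * (k / Cstar) ^ (-((lplus - lam i) / p i))} ∩ E) := by
  have hN' : (0 : ℝ) < N := by exact_mod_cast hN
  have hp0 (i) : 0 < p i := zero_lt_one.trans (hp i)
  have hC0 : 0 < Cstar := zero_lt_one.trans hCstar
  have hlogC : 0 < Real.log Cstar := Real.log_pos hCstar
  obtain ⟨j, hj⟩ := hpplus.1
  have hpplus0 : 0 < pplus := hj ▸ hp0 j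
  have hsum_pos : 0 < ∑ i, 1 / p i :=
    Finset.sum_pos (fun i _ => one_div_pos.2 (hp0 i)) ⟨j, Finset.mem_univ j⟩
  have hpbar0 : 0 < pbar := one_div_pos.1 (hpbar ▸ by positivity)
  have hsum : ∑ i, 1 / p i = N / pbar := by
    rw [div_eq_mul_one_div, hpbar]
    field_simp
  have hgap_nonneg (i) : 0 ≤ lplus - lam i := sub_nonneg.2 (hlplus.2 ⟨i, rfl⟩)
  have hgap_le (i) : lplus - lam i ≤ lplus - lminus :=
    sub_le_sub_left (hlminus.2 ⟨i, rfl⟩) _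
  have hwidth (i) : (4 * r) ^ (pplus / p i) * (k / Cstar) ^ (-((lplus - lam i) / p i)) =
      r ^ (pplus / p i) * k ^ (-((lplus - lam i) / p i)) *
        (4 ^ (pplus / p i) * Cstar ^ ((lplus - lam i) / p i)) := by
    rw [Real.mul_rpow (by norm_num) hr.le, Real.div_rpow hk.le hC0.le,
      Real.rpow_neg hC0.le, div_inv_eq_mul]
    ring
  have hprod : ∏ i, ((4 : ℝ) ^ (pplus / p i) * Cstar ^ ((lplus - lam i) / p i)) ≤
      4 ^ ((N : ℝ) * pplus / pbar + 1) := by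
    have hexp₁ : ∑ i, pplus / p i = (N : ℝ) * pplus / pbar := by
      simp_rw [div_eq_mul_one_div pplus]
      rw [← Finset.mul_sum, hsum]
      ring
    have hexp₂ : ∑ i, (lplus - lam i) / p i ≤ Real.log 4 / Real.log Cstar := by
      calc
        _ ≤ ∑ i, (lplus - lminus) * (1 / p i) := Finset.sum_le_sum fun i _ => by
          rw [div_eq_mul_one_div]
          exact mul_le_mul_of_nonneg_right (hgap_le i) (one_div_pos.2 (hp0 i)).le
        _ = (lplus - lminus) * (N / pbar) := by rw [← Finset.mul_sum, hsum]
        _ ≤ pbar * Real.log 4 / (N * Real.log Cstar) * (N / pbar) := by gcongr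
        _ = _ := by field_simp
    rw [Finset.prod_mul_distrib, ← Real.rpow_sum_of_pos (by norm_num),
      ← Real.rpow_sum_of_pos hC0, hexp₁, Real.rpow_add (by norm_num), Real.rpow_one]
    gcongr
    calc
      _ ≤ Cstar ^ (Real.log 4 / Real.log Cstar) :=
        Real.rpow_le_rpow_of_exponent_le hCstar.le hexp₂
      _ = 4 := by
        rw [Real.rpow_def_of_pos hC0, mul_div_cancel₀ _ hlogC.ne', Real.exp_log (by norm_num)]
  simp_rw [hwidth]
  refine density_box_mul y _ _ (fun i => by positivity) (fun i => ?_) hprod hα₀.1.le E hdensity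
  exact one_le_mul_of_one_le_of_one_le
    (Real.one_le_rpow (by norm_num) (div_nonneg hpplus0.le (hp0 i).le))
    (Real.one_le_rpow hCstar.le (div_nonneg (hgap_nonneg i) (hp0 i).le))
end

section
/- Let m > 0, k > 0, ε ∈ (0,1], and let u be a real number with 0 ≤ u ≤ ε·k. Then ∫_0^{k^m − u^m} s·(k^m − s)^{(1−m)/m} ds ≥ (m²/(m+1))·k^{m+1}·(1 − ((m+1)/m)·ε). -/
/-- Closed form of the parabolic weight `g₋(uᵐ, kᵐ)`. -/
theorem integral_mul_sub_rpow_eq {m k u : ℝ} (hm : 0 < m) (hk : 0 < k) (hu : 0 ≤ u) :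
    ∫ s in (0:ℝ)..(k ^ m - u ^ m), s * (k ^ m - s) ^ ((1 - m) / m)
      = m ^ 2 / (m + 1) * k ^ (m + 1) - m * k ^ m * u + m / (m + 1) * u ^ (m + 1) := by
  have hr : (1 - m) / m + 1 = m⁻¹ := by field_simp; ring
  have hm' : 0 < m⁻¹ := inv_pos.2 hm
  have hr1 : -1 < (1 - m) / m := by linarith
  have hpow {x : ℝ} (hx : 0 ≤ x) : (x ^ m) ^ (m⁻¹ + 1) = x ^ (m + 1) := by
    rw [← Real.rpow_mul hx]
    congr 1
    field_simp
    ring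
  have hsub := intervalIntegral.integral_comp_sub_left (a := 0) (b := k ^ m - u ^ m)
    (fun t : ℝ => (k ^ m - t) * t ^ ((1 - m) / m)) (k ^ m)
  simp only [sub_sub_cancel, sub_zero] at hsub
  have hcongr : ∫ t in (u ^ m)..(k ^ m), (k ^ m - t) * t ^ ((1 - m) / m)
      = ∫ t in (u ^ m)..(k ^ m), (k ^ m * t ^ ((1 - m) / m) - t ^ m⁻¹) := by
    refine intervalIntegral.integral_congr fun t ht => ?_
    have ht0 : 0 ≤ t := (le_min (Real.rpow_nonneg hu m) (Real.rpow_nonneg hk.le m)).trans ht.1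
    rw [← hr, Real.rpow_add_one' ht0 (by rw [hr]; exact hm'.ne')]
    ring
  rw [hsub, hcongr, intervalIntegral.integral_sub
      ((intervalIntegral.intervalIntegrable_rpow' hr1).const_mul _)
      (intervalIntegral.intervalIntegrable_rpow' (by linarith)),
    intervalIntegral.integral_const_mul, integral_rpow (Or.inl hr1),
    integral_rpow (Or.inl (by linarith)), hr, hpow hk.le, hpow hu,
    Real.rpow_rpow_inv hk.le hm.ne', Real.rpow_rpow_inv hu hm.ne', Real.rpow_add_one hk.ne']
  field_simp
  ring

/-- lower bound on the parabolic weight `g₋` when `0 ≤ u ≤ ε·k`: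
`∫_0^{k^m − u^m} s·(k^m − s)^{(1−m)/m} ds ≥ (m²/(m+1))·k^{m+1}·(1 − ((m+1)/m)·ε)`. -/
theorem g_minus_lower_bound (m k ε u : ℝ) (hm : 0 < m) (hk : 0 < k)
    (hε : ε ∈ Set.Ioc (0:ℝ) 1) (hu : 0 ≤ u) (huk : u ≤ ε * k) :
    m ^ 2 / (m + 1) * k ^ (m + 1) * (1 - (m + 1) / m * ε)
      ≤ ∫ s in (0:ℝ)..(k ^ m - u ^ m), s * (k ^ m - s) ^ ((1 - m) / m) := by
  rw [integral_mul_sub_rpow_eq hm hk hu]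
  have hlin : m * k ^ m * u ≤ m * k ^ m * (ε * k) := by gcongr
  have hnonneg : 0 ≤ m / (m + 1) * u ^ (m + 1) := by positivity
  have hexpand : m ^ 2 / (m + 1) * k ^ (m + 1) * (1 - (m + 1) / m * ε)
      = m ^ 2 / (m + 1) * k ^ (m + 1) - m * k ^ m * (ε * k) := by
    rw [Real.rpow_add_one hk.ne']
    field_simp
  linarith
end

section
/- Let N ≥ 2 be an integer, p_1,…,p_N > 1 with harmonic mean p defined by 1/p = (1/N)·Σ_{i=1}^N 1/p_i satisfying p < N, and let α_1,…,α_N > 0 with α := (1/N)·Σ_{i=1}^N α_i. Set p* := Np/(N−p), p*_α := p*·α, fix σ ∈ [1, p*_α] and θ ∈ [0, p/p*], and let δ := θ·p*_α + σ·(1−θ). Then there exists a constant c > 0, depending only on N, p_1,…,p_N, α_1,…,α_N, θ and σ (in particular independent of the domain, of T and of the function), such that: for every open rectangular box Ω ⊆ ℝ^N, every T > 0, and every nonnegative continuous function φ : ℝ^N × [0,T] → ℝ such that for each t ∈ (0,T] the functions x ↦ φ(x,t) and x ↦ φ(x,t)^{α_i} (i = 1,…,N) are continuously differentiable on ℝ^N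 and φ(·,t) vanishes outside a compact subset of Ω, one has ∫_0^T ∫_Ω φ(x,t)^δ dx dt ≤ c · T^{1−θ·p*/p} · ( sup_{t ∈ (0,T]} ∫_Ω φ(x,t)^σ dx )^{1−θ} · ∏_{i=1}^N ( ∫_0^T ∫_Ω |∂_{x_i}(φ(x,t)^{α_i})|^{p_i} dx dt )^{θ·p*/(N·p_i)}. -/
open MeasureTheory

theorem lintegral_prod_lintegral_update_rpow_le {N : ℕ} (hN : 2 ≤ N)
    {g : Fin N → (Fin N → ℝ) → ENNReal} (hg : ∀ i, Measurable (g i))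
    (hfin : ∀ i, ∫⁻ x, g i x ≠ ⊤) :
    ∫⁻ x, ∏ i, (∫⁻ y, g i (Function.update x i y)) ^ (1 / ((N : ℝ) - 1)) ≤
      (N : ENNReal) ^ ((N : ℝ) / (N - 1)) * ∏ i, (∫⁻ x, g i x) ^ (1 / ((N : ℝ) - 1)) := by
  have hN' : (2 : ℝ) ≤ N := by exact_mod_cast hN
  have hr : 0 ≤ 1 / ((N : ℝ) - 1) := by apply one_div_nonneg.2; linarith
  have key : ∀ ε : NNReal, ε ≠ 0 →
      ∫⁻ x, ∏ i, (∫⁻ y, g i (Function.update x i y)) ^ (1 / ((N : ℝ) - 1)) ≤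
        (N : ENNReal) ^ ((N : ℝ) / (N - 1)) *
          ∏ i, ((∫⁻ x, g i x) + ε) ^ (1 / ((N : ℝ) - 1)) := by
    intro ε hε
    set J : Fin N → ENNReal := fun i => (∫⁻ x, g i x) + ε with hJ
    have hJ0 : ∀ i, J i ≠ 0 := fun i => by simp [hJ, hε]
    have hJt : ∀ i, J i ≠ ⊤ := fun i => by simp [hJ, hfin i]
    set f : (Fin N → ℝ) → ENNReal := fun x => ∑ i, (J i)⁻¹ * g i x with hf
    have hfm : Measurable f := Finset.measurable_sum _ fun i _ => (hg i).const_mul _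
    have hgf : ∀ i x, g i x ≤ J i * f x := by
      intro i x
      calc g i x = J i * ((J i)⁻¹ * g i x) := by
            rw [← mul_assoc, ENNReal.mul_inv_cancel (hJ0 i) (hJt i), one_mul]
        _ ≤ J i * f x := by
            gcongr
            exact Finset.single_le_sum (f := fun i => (J i)⁻¹ * g i x)
              (fun _ _ => zero_le) (Finset.mem_univ i)
    have hconj : Real.HolderConjugate (Fintype.card (Fin N)) ((N : ℝ) / (N - 1)) := by
      rw [Fintype.card_fin, Real.holderConjugate_iff]
      refine ⟨by linarith, ?_⟩
      field_simp
      ring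
    have hfint : ∫⁻ x, f x ≤ N := by
      rw [hf, lintegral_finsetSum _ fun i _ => (hg i).const_mul _]
      calc ∑ i, ∫⁻ x, (J i)⁻¹ * g i x ≤ ∑ _i : Fin N, (1 : ENNReal) := by
            refine Finset.sum_le_sum fun i _ => ?_
            rw [lintegral_const_mul _ (hg i), mul_comm, ← div_eq_mul_inv]
            exact ENNReal.div_le_of_le_mul (by simp [hJ])
        _ = N := by simp
    calc ∫⁻ x, ∏ i, (∫⁻ y, g i (Function.update x i y)) ^ (1 / ((N : ℝ) - 1))
        ≤ ∫⁻ x, (∏ i, J i ^ (1 / ((N : ℝ) - 1))) *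
            ∏ i, (∫⁻ y, f (Function.update x i y)) ^ (1 / ((N : ℝ) - 1)) := by
          refine lintegral_mono fun x => ?_
          rw [← Finset.prod_mul_distrib]
          refine Finset.prod_le_prod' fun i _ => ?_
          rw [← ENNReal.mul_rpow_of_nonneg _ _ hr, ← lintegral_const_mul' _ _ (hJt i)]
          gcongr with y
          exact hgf i _
      _ = (∏ i, J i ^ (1 / ((N : ℝ) - 1))) *
            ∫⁻ x, ∏ i, (∫⁻ y, f (Function.update x i y)) ^ (1 / ((N : ℝ) - 1)) := by
          refine lintegral_const_mul' _ _ (ENNReal.prod_ne_top fun i _ => ?_)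
          exact ENNReal.rpow_ne_top_of_nonneg hr (hJt i)
      _ ≤ (∏ i, J i ^ (1 / ((N : ℝ) - 1))) * (N : ENNReal) ^ ((N : ℝ) / (N - 1)) := by
          gcongr
          have := lintegral_prod_lintegral_pow_le (fun _ : Fin N => (volume : Measure ℝ)) hconj hfm
          rw [Fintype.card_fin, ← volume_pi] at this
          exact this.trans (ENNReal.rpow_le_rpow hfint hconj.symm.nonneg)
      _ = _ := mul_comm _ _
  have hNt : (N : ENNReal) ^ ((N : ℝ) / (N - 1)) ≠ ⊤ :=
    ENNReal.rpow_ne_top_of_nonneg (div_nonneg (by linarith) (by linarith)) (ENNReal.natCast_ne_top N)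
  have hlim : Filter.Tendsto (fun ε : NNReal => (N : ENNReal) ^ ((N : ℝ) / (N - 1)) *
      ∏ i, ((∫⁻ x, g i x) + ε) ^ (1 / ((N : ℝ) - 1))) (nhdsWithin 0 {0}ᶜ)
      (nhds ((N : ENNReal) ^ ((N : ℝ) / (N - 1)) *
        ∏ i, (∫⁻ x, g i x) ^ (1 / ((N : ℝ) - 1)))) := by
    refine Filter.Tendsto.mono_left ?_ nhdsWithin_le_nhds
    refine ENNReal.Tendsto.const_mul ?_ (Or.inr hNt)
    refine ENNReal.tendsto_finsetProd_of_ne_top _ (fun i _ => ?_) fun i _ =>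
      ENNReal.rpow_ne_top_of_nonneg hr (hfin i)
    have hc : Continuous fun ε : NNReal => ((∫⁻ x, g i x) + ε) ^ (1 / ((N : ℝ) - 1)) :=
      ENNReal.continuous_rpow_const.comp (continuous_const.add ENNReal.continuous_coe)
    simpa using hc.tendsto 0
  refine ge_of_tendsto hlim ?_
  filter_upwards [self_mem_nhdsWithin] with ε hε using key ε hε

theorem enorm_le_lintegral_enorm_fderiv_update {N : ℕ} {w : (Fin N → ℝ) → ℝ}
    (hw : ContDiff ℝ 1 w) (hws : HasCompactSupport w) (x : Fin N → ℝ) (i : Fin N) :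
    ‖w x‖ₑ ≤ ∫⁻ y, ‖fderiv ℝ w (Function.update x i y) (Pi.single i 1)‖ₑ := by
  calc ‖w x‖ₑ ≤ ∫⁻ y in Set.Iic (x i), ‖deriv (w ∘ Function.update x i) y‖ₑ := by
        apply le_trans (by simp) (HasCompactSupport.enorm_le_lintegral_Ici_deriv _ _ _)
        · exact hw.comp (by convert! contDiff_update 1 x i)
        · exact hws.comp_isClosedEmbedding (isClosedEmbedding_update x i)
    _ ≤ ∫⁻ y, ‖deriv (w ∘ Function.update x i) y‖ₑ := setLIntegral_le_lintegral _ _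
    _ = ∫⁻ y, ‖fderiv ℝ w (Function.update x i y) (Pi.single i 1)‖ₑ := by
        refine lintegral_congr fun y => ?_
        rw [fderiv_comp_deriv _ (hw.differentiable one_ne_zero).differentiableAt
          (hasDerivAt_update x i y).differentiableAt, deriv_update]

/-- A Gagliardo-Nirenberg inequality with a different function in each coordinate direction. -/
theorem lintegral_prod_enorm_rpow_le {N : ℕ} (hN : 2 ≤ N) {w : Fin N → (Fin N → ℝ) → ℝ}
    (hw : ∀ i, ContDiff ℝ 1 (w i)) (hws : ∀ i, HasCompactSupport (w i)) :
    ∫⁻ x, ∏ i, ‖w i x‖ₑ ^ (1 / ((N : ℝ) - 1)) ≤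
      (N : ENNReal) ^ ((N : ℝ) / (N - 1)) *
        ∏ i, (∫⁻ x, ‖fderiv ℝ (w i) x (Pi.single i 1)‖ₑ) ^ (1 / ((N : ℝ) - 1)) := by
  have hN' : (2 : ℝ) ≤ N := by exact_mod_cast hN
  have hr : 0 ≤ 1 / ((N : ℝ) - 1) := by apply one_div_nonneg.2; linarith
  have hc : ∀ i, Continuous fun x => fderiv ℝ (w i) x (Pi.single i 1) := fun i =>
    ((hw i).continuous_fderiv one_ne_zero).clm_apply continuous_const
  refine le_trans (lintegral_mono fun x => Finset.prod_le_prod' fun i _ =>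
    ENNReal.rpow_le_rpow (enorm_le_lintegral_enorm_fderiv_update (hw i) (hws i) x i) hr)
    (lintegral_prod_lintegral_update_rpow_le hN
      (g := fun i x => ‖fderiv ℝ (w i) x (Pi.single i 1)‖ₑ)
      (fun i => (hc i).measurable.enorm) fun i => ?_)
  have hcs : HasCompactSupport fun x => fderiv ℝ (w i) x (Pi.single i 1) :=
    (hws i).fderiv_apply (𝕜 := ℝ) _
  exact ((hc i).integrable_of_hasCompactSupport hcs).2.ne

theorem contDiff_rpow_of_le {E : Type*} [NormedAddCommGroup E] [NormedSpace ℝ E] {v : E → ℝ}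
    (hv : ∀ x, 0 ≤ v x) {α s : ℝ} (hα : 0 < α) (hs : α ≤ s)
    (hw : ContDiff ℝ 1 fun x => v x ^ α) : ContDiff ℝ 1 fun x => v x ^ s := by
  have : (fun x => v x ^ s) = fun x => (v x ^ α) ^ (s / α) := by
    funext x
    rw [← Real.rpow_mul (hv x), mul_div_cancel₀ _ hα.ne']
  rw [this]
  exact hw.rpow_const_of_le (by rw [Nat.cast_one, one_le_div hα]; exact hs)

/-- Hölder's inequality for the gradient of a power of a nonnegative function. -/
theorem lintegral_enorm_fderiv_rpow_le {N : ℕ} {v : (Fin N → ℝ) → ℝ} (hv : ∀ x, 0 ≤ v x)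
    (hvc : Continuous v) {α q r : ℝ} (hα : 0 < α) (hq : 0 < q) (hr : 1 < r)
    (hw : ContDiff ℝ 1 fun x => v x ^ α) (e : Fin N → ℝ) :
    ∫⁻ x, ‖fderiv ℝ (fun z => v z ^ (α + q * (1 - 1 / r))) x e‖ₑ ≤
      ENNReal.ofReal ((α + q * (1 - 1 / r)) / α) *
        ((∫⁻ x, ENNReal.ofReal (v x ^ q)) ^ (1 - 1 / r) *
          (∫⁻ x, ENNReal.ofReal (|fderiv ℝ (fun z => v z ^ α) x e| ^ r)) ^ (1 / r)) := by
  have hr0 : 0 < r := by linarith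
  have hr1 : 0 < 1 - 1 / r := by
    rw [sub_pos, div_lt_one hr0]; exact hr
  set s := α + q * (1 - 1 / r) with hs
  have hαs : α < s := by rw [hs]; nlinarith [mul_pos hq hr1]
  have hsα : 1 ≤ s / α := by rw [one_le_div hα]; exact hαs.le
  have hpt : ∀ x, ‖fderiv ℝ (fun z => v z ^ s) x e‖ₑ = ENNReal.ofReal (s / α) *
      (ENNReal.ofReal (v x ^ q) ^ (1 - 1 / r) *
        ENNReal.ofReal (|fderiv ℝ (fun z => v z ^ α) x e| ^ r) ^ (1 / r)) := by
    intro x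
    have hfun : (fun x => v x ^ s) = fun x => (v x ^ α) ^ (s / α) := by
      funext x
      rw [← Real.rpow_mul (hv x), mul_div_cancel₀ _ hα.ne']
    have hd : fderiv ℝ (fun z => v z ^ s) x =
        (s / α * (v x ^ α) ^ (s / α - 1)) • fderiv ℝ (fun z => v z ^ α) x := by
      rw [hfun]
      exact ((hw.differentiable one_ne_zero x).hasFDerivAt.rpow_const (Or.inr hsα)).fderiv
    have hpow : (v x ^ α) ^ (s / α - 1) = (v x ^ q) ^ (1 - 1 / r) := by
      rw [← Real.rpow_mul (hv x), ← Real.rpow_mul (hv x)]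
      congr 1
      rw [mul_sub, mul_div_cancel₀ _ hα.ne', hs]
      ring
    have habs : (|fderiv ℝ (fun z => v z ^ α) x e| ^ r) ^ (1 / r) =
        |fderiv ℝ (fun z => v z ^ α) x e| := by
      rw [← Real.rpow_mul (abs_nonneg _), mul_one_div_cancel hr0.ne', Real.rpow_one]
    have hq0 : 0 ≤ v x ^ q := Real.rpow_nonneg (hv x) _
    rw [ENNReal.ofReal_rpow_of_nonneg hq0 hr1.le,
      ENNReal.ofReal_rpow_of_nonneg (Real.rpow_nonneg (abs_nonneg _) _) (by positivity), habs,
      ← ENNReal.ofReal_mul (Real.rpow_nonneg hq0 _), ← ENNReal.ofReal_mul (by linarith), hd, hpow,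
      Real.enorm_eq_ofReal_abs, smul_apply, smul_eq_mul, abs_mul,
      abs_of_nonneg (mul_nonneg (by linarith) (Real.rpow_nonneg hq0 _)), mul_assoc]
  simp_rw [hpt]
  rw [lintegral_const_mul' _ _ ENNReal.ofReal_ne_top]
  gcongr
  refine ENNReal.lintegral_mul_norm_pow_le ?_ ?_ hr1.le (by positivity) (by ring)
  · exact (hvc.measurable.pow_const q).ennreal_ofReal.aemeasurable
  · have hc : Continuous fun x => fderiv ℝ (fun z => v z ^ α) x e :=
      (hw.continuous_fderiv one_ne_zero).clm_apply continuous_const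
    exact (hc.abs.measurable.pow_const r).ennreal_ofReal.aemeasurable

theorem ennreal_rpow_sum {ι : Type*} {s : Finset ι} {x : ENNReal} (h0 : x ≠ 0) (ht : x ≠ ⊤)
    (f : ι → ℝ) : x ^ ∑ i ∈ s, f i = ∏ i ∈ s, x ^ f i := by
  induction s using Finset.cons_induction with
  | empty => simp
  | cons i s hi ih => rw [Finset.sum_cons, Finset.prod_cons, ENNReal.rpow_add _ _ h0 ht, ih]

/-- **Troisi's anisotropic Sobolev inequality**, for nonnegative functions with powers depending
on the coordinate direction. -/
theorem exists_lintegral_rpow_le_prod_lintegral_fderiv {N : ℕ} (hN : 2 ≤ N) {p α : Fin N → ℝ}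
    (hp : ∀ i, 1 < p i) (hα : ∀ i, 0 < α i) {m q : ℝ} (hm0 : 0 < m)
    (hm : m * (∑ i, 1 / p i - 1) = 1) (hq : q = m * ∑ i, α i) :
    ∃ C : ENNReal, C ≠ ⊤ ∧ ∀ v : (Fin N → ℝ) → ℝ, (∀ x, 0 ≤ v x) → Continuous v →
      HasCompactSupport v → (∀ i, ContDiff ℝ 1 fun x => v x ^ α i) →
      ∫⁻ x, ENNReal.ofReal (v x ^ q) ≤ C *
        ∏ i, (∫⁻ x, ENNReal.ofReal
          (|fderiv ℝ (fun z => v z ^ α i) x (Pi.single i 1)| ^ p i)) ^ (m / p i) := by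
  have hN' : (2 : ℝ) ≤ N := by exact_mod_cast hN
  have hN1 : 0 < (N : ℝ) - 1 := by linarith
  set n : ℝ := 1 / ((N : ℝ) - 1) with hn
  have hn0 : 0 < n := by positivity
  have hnN : n * ((N : ℝ) - 1) = 1 := by rw [hn]; field_simp
  have hq0 : 0 < q := by
    rw [hq]
    have : Nonempty (Fin N) := ⟨⟨0, by omega⟩⟩
    exact mul_pos hm0 (Finset.sum_pos (fun i _ => hα i) Finset.univ_nonempty)
  have hp1 : ∀ i, 0 < 1 - 1 / p i := fun i => by
    have := hp i
    rw [sub_pos, div_lt_one (by linarith)]; exact this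
  set s : Fin N → ℝ := fun i => α i + q * (1 - 1 / p i) with hs
  have hαs : ∀ i, α i ≤ s i := fun i => by
    have := mul_pos hq0 (hp1 i)
    simp only [hs]; linarith
  have hs0 : ∀ i, 0 < s i := fun i => (hα i).trans_le (hαs i)
  have hsum1 : ∑ i, (1 - 1 / p i) = N - ∑ i, 1 / p i := by simp
  have hsum : ∑ i, s i * n = q := by
    rw [← Finset.sum_mul]
    simp only [hs]
    rw [Finset.sum_add_distrib, ← Finset.mul_sum, hsum1]
    have h1 : ∑ i, α i = q * (∑ i, 1 / p i - 1) := by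
      rw [hq]; linear_combination (-∑ i, α i) * hm
    rw [h1]
    linear_combination q * hnN
  set e : ℝ := ∑ i, (1 - 1 / p i) * n with he
  have he' : (1 - e) * ((N - 1) * m) = 1 := by
    rw [he, ← Finset.sum_mul, hsum1]
    linear_combination hm - (N - ∑ i, 1 / p i) * m * hnN
  set K : ENNReal := (N : ENNReal) ^ ((N : ℝ) / (N - 1)) *
    ∏ i, ENNReal.ofReal (s i / α i) ^ n with hK
  have hKt : K ≠ ⊤ := by
    refine ENNReal.mul_ne_top (ENNReal.rpow_ne_top_of_nonneg (by positivity)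
      (ENNReal.natCast_ne_top N)) (ENNReal.prod_ne_top fun i _ => ?_)
    exact ENNReal.rpow_ne_top_of_nonneg hn0.le ENNReal.ofReal_ne_top
  have hexp : 0 < ((N : ℝ) - 1) * m := by positivity
  refine ⟨K ^ (((N : ℝ) - 1) * m), ENNReal.rpow_ne_top_of_nonneg hexp.le hKt, ?_⟩
  intro v hv hvc hvs hw
  set D : Fin N → ENNReal := fun i => ∫⁻ x, ENNReal.ofReal
    (|fderiv ℝ (fun z => v z ^ α i) x (Pi.single i 1)| ^ p i) with hD
  set A : ENNReal := ∫⁻ x, ENNReal.ofReal (v x ^ q) with hA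
  have hsupp : ∀ {r : ℝ}, 0 < r → HasCompactSupport fun x => v x ^ r := fun {r} hr =>
    hvs.comp_left (g := fun y : ℝ => y ^ r) (Real.zero_rpow hr.ne')
  have hAt : A ≠ ⊤ := by
    have := ((hvc.rpow_const fun x => Or.inr hq0.le).integrable_of_hasCompactSupport (μ := volume)
      (hsupp hq0)).2.ne
    simpa [hA, Real.enorm_eq_ofReal (Real.rpow_nonneg (hv _) _)] using this
  rcases eq_or_ne A 0 with hA0 | hA0
  · simp [hA0]
  have hbound : A ≤ K * (∏ i, D i ^ (n / p i)) * A ^ e := by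
    calc A = ∫⁻ x, ∏ i, ‖v x ^ s i‖ₑ ^ n := by
          refine lintegral_congr fun x => ?_
          have : ∀ i, ‖v x ^ s i‖ₑ ^ n = ENNReal.ofReal (v x ^ (s i * n)) := fun i => by
            rw [Real.enorm_eq_ofReal (Real.rpow_nonneg (hv _) _),
              ENNReal.ofReal_rpow_of_nonneg (Real.rpow_nonneg (hv _) _) hn0.le,
              ← Real.rpow_mul (hv x)]
          simp_rw [this]
          rw [← ENNReal.ofReal_prod_of_nonneg fun i _ => Real.rpow_nonneg (hv _) _,
            ← Real.rpow_sum_of_nonneg (hv x) fun i _ => mul_nonneg (hs0 i).le hn0.le, hsum]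
      _ ≤ (N : ENNReal) ^ ((N : ℝ) / (N - 1)) *
          ∏ i, (∫⁻ x, ‖fderiv ℝ (fun x => v x ^ s i) x (Pi.single i 1)‖ₑ) ^ n :=
        lintegral_prod_enorm_rpow_le hN (w := fun i x => v x ^ s i)
          (fun i => contDiff_rpow_of_le hv (hα i) (hαs i) (hw i)) fun i => hsupp (hs0 i)
      _ ≤ (N : ENNReal) ^ ((N : ℝ) / (N - 1)) *
          ∏ i, (ENNReal.ofReal (s i / α i) *
            (A ^ (1 - 1 / p i) * D i ^ (1 / p i))) ^ n := by
        gcongr with i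
        exact lintegral_enorm_fderiv_rpow_le hv hvc (hα i) hq0 (hp i) (hw i) _
      _ = K * (∏ i, D i ^ (n / p i)) * A ^ e := by
        have : ∀ i, (ENNReal.ofReal (s i / α i) * (A ^ (1 - 1 / p i) * D i ^ (1 / p i))) ^ n =
            ENNReal.ofReal (s i / α i) ^ n * D i ^ (n / p i) * A ^ ((1 - 1 / p i) * n) := by
          intro i
          rw [ENNReal.mul_rpow_of_nonneg _ _ hn0.le, ENNReal.mul_rpow_of_nonneg _ _ hn0.le,
            ← ENNReal.rpow_mul, ← ENNReal.rpow_mul, one_div_mul_eq_div]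
          ring
        simp_rw [this]
        rw [Finset.prod_mul_distrib, Finset.prod_mul_distrib, hK, he]
        rw [ennreal_rpow_sum hA0 hAt]
        ring
  have hA1 : A ^ (1 - e) ≤ K * ∏ i, D i ^ (n / p i) := by
    rw [ENNReal.rpow_sub _ _ hA0 hAt, ENNReal.rpow_one]
    exact ENNReal.div_le_of_le_mul hbound
  calc A = (A ^ (1 - e)) ^ (((N : ℝ) - 1) * m) := by
        rw [← ENNReal.rpow_mul, he', ENNReal.rpow_one]
    _ ≤ (K * ∏ i, D i ^ (n / p i)) ^ (((N : ℝ) - 1) * m) := ENNReal.rpow_le_rpow hA1 hexp.le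
    _ = K ^ (((N : ℝ) - 1) * m) * ∏ i, D i ^ (m / p i) := by
        rw [ENNReal.mul_rpow_of_nonneg _ _ hexp.le, ← ENNReal.prod_rpow_of_nonneg hexp.le]
        congr 1
        refine Finset.prod_congr rfl fun i _ => ?_
        rw [← ENNReal.rpow_mul]
        congr 1
        linear_combination m / p i * hnN

theorem aemeasurable_lintegral_fderiv_rpow {N : ℕ} {α r T : ℝ} (hα : 0 < α) (hT : 0 ≤ T)
    {φ : (Fin N → ℝ) → ℝ → ℝ}
    (hφ : ContinuousOn (fun q : (Fin N → ℝ) × ℝ => φ q.1 q.2) (Set.univ ×ˢ Set.Icc 0 T))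
    (e : Fin N → ℝ) (μ : Measure (Fin N → ℝ)) [SFinite μ] :
    AEMeasurable (fun t => ∫⁻ x, ENNReal.ofReal (|fderiv ℝ (fun z => φ z t ^ α) x e| ^ r) ∂μ)
      (volume.restrict (Set.Ioc 0 T)) := by
  let ψ : ℝ → (Fin N → ℝ) → ℝ := fun t x => φ x (Set.projIcc 0 T hT t) ^ α
  have hψ : Continuous ψ.uncurry := by
    have h1 : Continuous fun y : ℝ × (Fin N → ℝ) => φ y.2 (Set.projIcc 0 T hT y.1) :=
      hφ.comp_continuous
        (f := fun y : ℝ × (Fin N → ℝ) => (y.2, ((Set.projIcc 0 T hT y.1 : Set.Icc 0 T) : ℝ)))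
        (continuous_snd.prodMk
          (continuous_subtype_val.comp (continuous_projIcc.comp continuous_fst)))
        fun y => ⟨Set.mem_univ _, Subtype.coe_prop _⟩
    exact h1.rpow_const fun _ => Or.inr hα.le
  have hmeas : Measurable fun t => ∫⁻ x, ENNReal.ofReal (|fderiv ℝ (ψ t) x e| ^ r) ∂μ := by
    refine Measurable.lintegral_prod_right'
      (f := fun y : ℝ × (Fin N → ℝ) => ENNReal.ofReal (|fderiv ℝ (ψ y.1) y.2 e| ^ r)) ?_
    exact ((measurable_fderiv_apply_const_with_param ℝ hψ e).abs.pow_const r).ennreal_ofReal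
  refine ⟨_, hmeas, ?_⟩
  filter_upwards [ae_restrict_mem measurableSet_Ioc] with t ht
  simp only [ψ, Set.projIcc_of_mem hT (Set.Ioc_subset_Icc_self ht)]

/-- the anisotropic parabolic Sobolev embedding (inequality (PS)),
stated for nonnegative functions, continuous in space-time, smooth in space with
compact support in an open rectangular box `Ω`, with all integrals taken in the
Lebesgue (`lintegral`) sense so that the inequality is trivial when the
right-hand side is unbounded. -/
theorem anisotropic_parabolic_sobolev_embedding
    (N : ℕ) (hN : 2 ≤ N) (p α : Fin N → ℝ) (hp : ∀ i, 1 < p i)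
    (pbar : ℝ) (hpbar : 1 / pbar = (1 / (N : ℝ)) * ∑ i, 1 / p i) (hpN : pbar < N)
    (hα : ∀ i, 0 < α i) (αbar : ℝ) (hαbar : αbar = (1 / (N : ℝ)) * ∑ i, α i)
    (pstar : ℝ) (hpstar : pstar = (N : ℝ) * pbar / ((N : ℝ) - pbar))
    (pstarα : ℝ) (hpstarα : pstarα = pstar * αbar)
    (σ : ℝ) (hσ : σ ∈ Set.Icc 1 pstarα)
    (θ : ℝ) (hθ : θ ∈ Set.Icc 0 (pbar / pstar))
    (δ : ℝ) (hδ : δ = θ * pstarα + σ * (1 - θ)) :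
    ∃ c : ℝ, 0 < c ∧
      ∀ (a b : Fin N → ℝ) (T : ℝ), 0 < T →
        ∀ φ : (Fin N → ℝ) → ℝ → ℝ,
          (∀ x t, 0 ≤ φ x t) →
          ContinuousOn (fun q : (Fin N → ℝ) × ℝ => φ q.1 q.2)
            (Set.univ ×ˢ Set.Icc 0 T) →
          (∀ t ∈ Set.Ioc (0 : ℝ) T, ContDiff ℝ 1 fun x => φ x t) →
          (∀ t ∈ Set.Ioc (0 : ℝ) T, ∀ i, ContDiff ℝ 1 fun x => φ x t ^ α i) →
          (∀ t ∈ Set.Ioc (0 : ℝ) T, ∃ K : Set (Fin N → ℝ), IsCompact K ∧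
            K ⊆ Set.univ.pi (fun j => Set.Ioo (a j) (b j)) ∧
            ∀ x ∉ K, φ x t = 0) →
          (∫⁻ t in Set.Ioc (0 : ℝ) T,
              ∫⁻ x in Set.univ.pi (fun j => Set.Ioo (a j) (b j)),
                ENNReal.ofReal (φ x t ^ δ))
            ≤ ENNReal.ofReal c * ENNReal.ofReal T ^ (1 - θ * pstar / pbar) *
              (⨆ t ∈ Set.Ioc (0 : ℝ) T,
                ∫⁻ x in Set.univ.pi (fun j => Set.Ioo (a j) (b j)),
                  ENNReal.ofReal (φ x t ^ σ)) ^ (1 - θ) *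
              ∏ i, (∫⁻ t in Set.Ioc (0 : ℝ) T,
                  ∫⁻ x in Set.univ.pi (fun j => Set.Ioo (a j) (b j)),
                    ENNReal.ofReal
                      (|fderiv ℝ (fun z => φ z t ^ α i) x (Pi.single i 1)| ^ p i))
                ^ (θ * pstar / ((N : ℝ) * p i)) := by
  have hN' : (2 : ℝ) ≤ N := by exact_mod_cast hN
  have hN0 : (0 : ℝ) < N := by linarith
  have : Nonempty (Fin N) := ⟨⟨0, by omega⟩⟩
  have hp0 : ∀ i, 0 < p i := fun i => by linarith [hp i]
  have hS0 : 0 < ∑ i, 1 / p i :=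
    Finset.sum_pos (fun i _ => one_div_pos.2 (hp0 i)) Finset.univ_nonempty
  have hpb : 0 < pbar := one_div_pos.1 (by rw [hpbar]; positivity)
  have hSN : ∑ i, 1 / p i = N / pbar := by
    rw [div_eq_mul_one_div, hpbar]
    field_simp
  have hNp : 0 < (N : ℝ) - pbar := by linarith
  have hps : 0 < pstar := by rw [hpstar]; positivity
  set m : ℝ := pstar / N with hm
  have hm0 : 0 < m := by positivity
  have hmS : m * (∑ i, 1 / p i - 1) = 1 := by
    rw [hSN, hm, hpstar]
    field_simp
  have hq : pstarα = m * ∑ i, α i := by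
    rw [hpstarα, hαbar, hm]
    ring
  have hq0 : 0 < pstarα := by
    rw [hq]
    exact mul_pos hm0 (Finset.sum_pos (fun i _ => hα i) Finset.univ_nonempty)
  have hθ0 : 0 ≤ θ := hθ.1
  have hθp : θ * pstar / pbar ≤ 1 := by
    rw [div_le_one hpb]
    exact (le_div_iff₀ hps).1 hθ.2
  have hθ1 : 0 ≤ 1 - θ := by
    have h1 : pbar / pstar ≤ 1 := by
      rw [div_le_one hps, hpstar, le_div_iff₀ hNp]
      nlinarith
    linarith [hθ.2]
  have hσ0 : 0 < σ := by linarith [hσ.1]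
  obtain ⟨C, hCt, hC⟩ := exists_lintegral_rpow_le_prod_lintegral_fderiv hN hp hα hm0 hmS hq
  have hCθ : C ^ θ ≠ ⊤ := ENNReal.rpow_ne_top_of_nonneg hθ0 hCt
  refine ⟨(C ^ θ).toReal + 1, by positivity, ?_⟩
  intro a b T hT φ hφ0 hφc hφd hφα hφK
  set Ω : Set (Fin N → ℝ) := Set.univ.pi fun j => Set.Ioo (a j) (b j) with hΩ
  set M : ENNReal := ⨆ t ∈ Set.Ioc (0 : ℝ) T, ∫⁻ x in Ω, ENNReal.ofReal (φ x t ^ σ) with hM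
  set D : Fin N → ℝ → ENNReal := fun i t => ∫⁻ x in Ω, ENNReal.ofReal
    (|fderiv ℝ (fun z => φ z t ^ α i) x (Pi.single i 1)| ^ p i) with hD
  have hDm : ∀ i, AEMeasurable (D i) (volume.restrict (Set.Ioc 0 T)) := fun i =>
    aemeasurable_lintegral_fderiv_rpow (hα i) hT.le hφc _ _
  have hslice : ∀ t ∈ Set.Ioc (0 : ℝ) T, ∫⁻ x in Ω, ENNReal.ofReal (φ x t ^ δ) ≤
      C ^ θ * M ^ (1 - θ) * ∏ i, D i t ^ (θ * pstar / ((N : ℝ) * p i)) := by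
    intro t ht
    have hcont : Continuous fun x => φ x t := (hφd t ht).continuous
    obtain ⟨L, hL, hLΩ, hL0⟩ := hφK t ht
    have hsob : ∫⁻ x in Ω, ENNReal.ofReal (φ x t ^ pstarα) ≤ C * ∏ i, D i t ^ (m / p i) := by
      refine (setLIntegral_le_lintegral _ _).trans ((hC _ (fun x => hφ0 x t) hcont
        (HasCompactSupport.intro hL hL0) (hφα t ht)).trans_eq ?_)
      congr 1
      refine Finset.prod_congr rfl fun i _ => ?_
      congr 1
      refine (setLIntegral_eq_of_support_subset ?_).symm
      refine Function.support_subset_iff'.2 fun x hx => ?_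
      have hev : (fun z => φ z t ^ α i) =ᶠ[nhds x] fun _ => (0 : ℝ) := by
        filter_upwards [hL.isClosed.isOpen_compl.mem_nhds fun h => hx (hLΩ h)] with z hz
        rw [hL0 z hz, Real.zero_rpow (hα i).ne']
      rw [hev.fderiv_eq]
      simp [Real.zero_rpow (hp0 i).ne']
    calc ∫⁻ x in Ω, ENNReal.ofReal (φ x t ^ δ)
        = ∫⁻ x in Ω, ENNReal.ofReal (φ x t ^ pstarα) ^ θ *
            ENNReal.ofReal (φ x t ^ σ) ^ (1 - θ) := by
          refine lintegral_congr fun x => ?_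
          have h0 := hφ0 x t
          rw [ENNReal.ofReal_rpow_of_nonneg (Real.rpow_nonneg h0 _) hθ0,
            ENNReal.ofReal_rpow_of_nonneg (Real.rpow_nonneg h0 _) hθ1,
            ← ENNReal.ofReal_mul (Real.rpow_nonneg (Real.rpow_nonneg h0 _) _),
            ← Real.rpow_mul h0, ← Real.rpow_mul h0,
            ← Real.rpow_add_of_nonneg h0 (by positivity) (by positivity), hδ, mul_comm θ]
      _ ≤ (∫⁻ x in Ω, ENNReal.ofReal (φ x t ^ pstarα)) ^ θ *
            (∫⁻ x in Ω, ENNReal.ofReal (φ x t ^ σ)) ^ (1 - θ) :=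
          ENNReal.lintegral_mul_norm_pow_le
            (hcont.measurable.pow_const _).ennreal_ofReal.aemeasurable
            (hcont.measurable.pow_const _).ennreal_ofReal.aemeasurable hθ0 hθ1 (by ring)
      _ ≤ (C * ∏ i, D i t ^ (m / p i)) ^ θ * M ^ (1 - θ) := by
          gcongr
          exact le_iSup₂ (f := fun t (_ : t ∈ Set.Ioc (0 : ℝ) T) =>
            ∫⁻ x in Ω, ENNReal.ofReal (φ x t ^ σ)) t ht
      _ = _ := by
          rw [ENNReal.mul_rpow_of_nonneg _ _ hθ0, ← ENNReal.prod_rpow_of_nonneg hθ0,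
            mul_right_comm]
          congr 1
          refine Finset.prod_congr rfl fun i _ => ?_
          rw [← ENNReal.rpow_mul, hm]
          congr 1
          have := hp0 i
          field_simp
  have hexp : 1 - θ * pstar / pbar + ∑ i, θ * pstar / ((N : ℝ) * p i) = 1 := by
    have : ∑ i, θ * pstar / ((N : ℝ) * p i) = θ * pstar / N * ∑ i, 1 / p i := by
      rw [Finset.mul_sum]
      refine Finset.sum_congr rfl fun i _ => ?_
      have := hp0 i
      field_simp
    rw [this, hSN]
    field_simp
    ring
  have htime : ∫⁻ t in Set.Ioc 0 T, ∏ i, D i t ^ (θ * pstar / ((N : ℝ) * p i)) ≤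
      ENNReal.ofReal T ^ (1 - θ * pstar / pbar) *
        ∏ i, (∫⁻ t in Set.Ioc 0 T, D i t) ^ (θ * pstar / ((N : ℝ) * p i)) := by
    have := ENNReal.lintegral_mul_prod_norm_pow_le (μ := volume.restrict (Set.Ioc 0 T))
      Finset.univ (g := fun _ => 1) aemeasurable_const (fun i _ => hDm i) _ hexp (by linarith)
      fun i _ => by have := hp0 i; positivity
    simpa using this
  calc ∫⁻ t in Set.Ioc (0 : ℝ) T, ∫⁻ x in Ω, ENNReal.ofReal (φ x t ^ δ)
      ≤ ∫⁻ t in Set.Ioc (0 : ℝ) T, C ^ θ * M ^ (1 - θ) *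
          ∏ i, D i t ^ (θ * pstar / ((N : ℝ) * p i)) :=
        setLIntegral_mono' measurableSet_Ioc hslice
    _ = C ^ θ * M ^ (1 - θ) *
          ∫⁻ t in Set.Ioc (0 : ℝ) T, ∏ i, D i t ^ (θ * pstar / ((N : ℝ) * p i)) :=
        lintegral_const_mul'' _
          (Finset.aemeasurable_fun_prod _ fun i _ => (hDm i).pow_const _)
    _ ≤ C ^ θ * M ^ (1 - θ) * (ENNReal.ofReal T ^ (1 - θ * pstar / pbar) *
          ∏ i, (∫⁻ t in Set.Ioc 0 T, D i t) ^ (θ * pstar / ((N : ℝ) * p i))) := by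
        gcongr
    _ = C ^ θ * ENNReal.ofReal T ^ (1 - θ * pstar / pbar) * M ^ (1 - θ) *
          ∏ i, (∫⁻ t in Set.Ioc 0 T, D i t) ^ (θ * pstar / ((N : ℝ) * p i)) := by
        ring
    _ ≤ _ := by
        gcongr
        exact ENNReal.le_ofReal_iff_toReal_le hCθ (by positivity) |>.2 (by linarith)
end
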